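/- Let γ > 0 satisfy γ < 4 − d and γ ≤ 2. Then there exists a constant C > 0 such that for all t > 0 and all x, y ∈ D, ∫_0^t ∫_D |G(x,z,t−r) − G(y,z,t−r)|² dz dr ≤ C |x−y|^γ. -/

import Mathlib

open MeasureTheory Real Set

noncomputable section

/-- The spatial domain `D = (0,π)^d` as a subset of Euclidean space. -/
def domD (d : ℕ) : Set (EuclideanSpace ℝ (Fin d)) :=
  {x | ∀ i, x i ∈ Set.Ioo (0 : ℝ) π}

/-- One-dimensional normalized cosine functions: `ε_0 = 1/√π`, `ε_j(x) = √(2/π) cos(jx)`. -/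
def eps1 (j : ℕ) (x : ℝ) : ℝ :=
  if j = 0 then 1 / Real.sqrt π else Real.sqrt (2 / π) * Real.cos (j * x)

/-- The product functions `ε_k(x) = ∏ i, ε_{k i}(x i)` for a multi-index `k ∈ ℕ^d`. -/
def epsk {d : ℕ} (k : Fin d → ℕ) (x : EuclideanSpace ℝ (Fin d)) : ℝ :=
  ∏ i, eps1 (k i) (x i)

/-- The eigenvalue `λ_k = ∑ i, k_i²`. -/
def lam {d : ℕ} (k : Fin d → ℕ) : ℝ := ∑ i, (k i : ℝ) ^ 2

/-- The Green's function of `−Δ²+Δ` with homogeneous Neumann boundary conditions on `D`: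
`G(x,y,t) = ∑_{k∈ℕ^d} e^{−(λ_k²+λ_k)t} ε_k(x) ε_k(y)`. -/
def green {d : ℕ} (x y : EuclideanSpace ℝ (Fin d)) (t : ℝ) : ℝ :=
  ∑' k : Fin d → ℕ, Real.exp (-(lam k ^ 2 + lam k) * t) * epsk k x * epsk k y

lemma summable_pi_prod (f : ℕ → ℝ) (hf0 : ∀ n, 0 ≤ f n) (hf : Summable f) (d : ℕ) :
    Summable (fun k : Fin d → ℕ => ∏ i, f (k i)) := by
  induction d with
  | zero => exact Summable.of_finite
  | succ n ih =>
    rw [← (Fin.consEquiv (fun _ : Fin (n+1) => ℕ)).summable_iff]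
    have := hf.mul_of_nonneg ih hf0 (fun k => Finset.prod_nonneg fun i _ => hf0 _)
    refine this.congr fun p => ?_
    simp [Fin.prod_univ_succ, Fin.consEquiv]

def sumk {d : ℕ} (k : Fin d → ℕ) : ℝ := ∑ i, (k i : ℝ)

lemma sumk_nonneg {d : ℕ} (k : Fin d → ℕ) : 0 ≤ sumk k :=
  Finset.sum_nonneg fun _ _ => Nat.cast_nonneg _

lemma le_sumk {d : ℕ} (k : Fin d → ℕ) (i : Fin d) : (k i : ℝ) ≤ sumk k :=
  Finset.single_le_sum (f := fun i => (k i : ℝ)) (fun _ _ => Nat.cast_nonneg _) (Finset.mem_univ i)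

lemma sumk_cases {d : ℕ} (k : Fin d → ℕ) : k = 0 ∨ 1 ≤ sumk k := by
  by_cases h : k = 0
  · exact Or.inl h
  · right
    obtain ⟨i, hi⟩ := Function.ne_iff.1 h
    refine le_trans ?_ (le_sumk k i)
    exact_mod_cast Nat.one_le_iff_ne_zero.2 hi

lemma summable_sumk {d : ℕ} (hd : 0 < d) (q : ℝ) (hq : (d : ℝ) < q) :
    Summable (fun k : Fin d → ℕ => sumk k ^ (-q)) := by
  have hd' : (0 : ℝ) < d := by exact_mod_cast hd
  have h1 : Summable (fun n : ℕ => ((1 : ℝ) + n) ^ (-q / d)) := by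
    have : Summable (fun n : ℕ => (n : ℝ) ^ (-q / d)) := by
      rw [Real.summable_nat_rpow, div_lt_iff₀ hd']; linarith
    have := (summable_nat_add_iff 1).2 this
    refine this.congr fun n => ?_
    push_cast; rw [add_comm]
  have h2 := (summable_pi_prod _ (fun n => by positivity) h1 d).mul_left (2 ^ q)
  refine Summable.of_nonneg_of_le (fun k => Real.rpow_nonneg (sumk_nonneg k) _) (fun k => ?_) h2
  rcases sumk_cases k with rfl | hk
  · have : sumk (0 : Fin d → ℕ) = 0 := by simp [sumk]
    rw [this, Real.zero_rpow (by linarith)]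
    positivity
  · have h0 := sumk_nonneg k
    have e1 : sumk k ^ (-q) ≤ ((1 + sumk k) / 2) ^ (-q) :=
      Real.rpow_le_rpow_of_nonpos (by linarith) (by linarith) (by linarith)
    refine e1.trans ?_
    rw [Real.div_rpow (by linarith) (by norm_num), Real.rpow_neg (by norm_num : (0:ℝ) ≤ 2), div_inv_eq_mul,
      mul_comm]
    gcongr
    have : (1 + sumk k) ^ (-q) = ∏ i : Fin d, (1 + sumk k) ^ (-q / d) := by
      rw [Finset.prod_const, ← Real.rpow_natCast, ← Real.rpow_mul (by linarith)]
      simp only [Finset.card_univ, Fintype.card_fin]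
      congr 1
      field_simp
    rw [this]
    refine Finset.prod_le_prod (fun i _ => by positivity) fun i _ => ?_
    have := le_sumk k i
    exact Real.rpow_le_rpow_of_nonpos (by positivity) (by linarith)
      (div_nonpos_of_nonpos_of_nonneg (by linarith) hd'.le)

lemma lam_nonneg {d : ℕ} (k : Fin d → ℕ) : 0 ≤ lam k := Finset.sum_nonneg fun i _ => by positivity

lemma sumk_le_lam {d : ℕ} (k : Fin d → ℕ) : sumk k ≤ lam k := by
  refine Finset.sum_le_sum fun i _ => ?_
  exact_mod_cast Nat.le_self_pow two_ne_zero _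

lemma sumk_sq_le {d : ℕ} (k : Fin d → ℕ) : sumk k ^ 2 ≤ d * lam k := by
  have := sq_sum_le_card_mul_sum_sq (s := Finset.univ) (f := fun i => (k i : ℝ))
  simpa [sumk, lam] using this

lemma summable_exp {d : ℕ} (s : ℝ) (hs : 0 < s) :
    Summable (fun k : Fin d → ℕ => Real.exp (-(lam k ^ 2 + lam k) * s)) := by
  have h1 : Summable (fun n : ℕ => Real.exp (-s) ^ n) :=
    summable_geometric_of_lt_one (by positivity) (by simpa using hs)
  refine Summable.of_nonneg_of_le (fun k => by positivity) (fun k => ?_)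
    (summable_pi_prod _ (fun n => by positivity) h1 d)
  have : ∏ i, Real.exp (-s) ^ (k i) = Real.exp (- sumk k * s) := by
    simp_rw [← Real.exp_nat_mul]
    rw [← Real.exp_sum, ← Finset.sum_mul, sumk]
    congr 1; ring
  rw [this]
  apply Real.exp_le_exp.2
  have := sumk_le_lam k
  nlinarith [sq_nonneg (lam k)]

lemma abs_eps1_le (j : ℕ) (a : ℝ) : |eps1 j a| ≤ 1 := by
  unfold eps1
  have hp := Real.pi_gt_three
  split_ifs
  · rw [abs_of_nonneg (by positivity), div_le_one (by positivity)]
    exact Real.one_le_sqrt.2 (by linarith)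
  · rw [abs_mul, abs_of_nonneg (Real.sqrt_nonneg _)]
    refine mul_le_one₀ ?_ (abs_nonneg _) (Real.abs_cos_le_one _)
    rw [Real.sqrt_le_one, div_le_one (by positivity)]; linarith

lemma abs_eps1_sub_le (j : ℕ) (a b : ℝ) : |eps1 j a - eps1 j b| ≤ j * |a - b| := by
  unfold eps1
  have hp := Real.pi_gt_three
  split_ifs with h
  · simp [h]
  · rw [← mul_sub, abs_mul, abs_of_nonneg (Real.sqrt_nonneg _)]
    have h1 : √(2 / π) ≤ 1 := by
      rw [Real.sqrt_le_one, div_le_one (by positivity)]; linarith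
    have h2 := Real.abs_cos_sub_cos_le (j * a) (j * b)
    rw [← mul_sub, abs_mul, Nat.abs_cast] at h2
    exact (mul_le_of_le_one_left (abs_nonneg _) h1).trans h2

lemma abs_epsk_le {d : ℕ} (k : Fin d → ℕ) (x : EuclideanSpace ℝ (Fin d)) : |epsk k x| ≤ 1 := by
  unfold epsk
  rw [Finset.abs_prod]
  exact Finset.prod_le_one (fun i _ => abs_nonneg _) fun i _ => abs_eps1_le _ _

lemma abs_prod_sub_prod_le' {ι : Type*} (s : Finset ι) (f g : ι → ℝ) (hf : ∀ i, |f i| ≤ 1)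
    (hg : ∀ i, |g i| ≤ 1) : |∏ i ∈ s, f i - ∏ i ∈ s, g i| ≤ ∑ i ∈ s, |f i - g i| := by
  classical
  induction s using Finset.induction_on with
  | empty => simp
  | insert a s ha ih =>
    rw [Finset.prod_insert ha, Finset.prod_insert ha, Finset.sum_insert ha]
    have e : f a * ∏ i ∈ s, f i - g a * ∏ i ∈ s, g i
      = (f a - g a) * ∏ i ∈ s, f i + g a * (∏ i ∈ s, f i - ∏ i ∈ s, g i) := by ring
    rw [e]
    refine (abs_add_le _ _).trans ?_
    rw [abs_mul, abs_mul]
    have h1 : |∏ i ∈ s, f i| ≤ 1 := by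
      rw [Finset.abs_prod]
      exact Finset.prod_le_one (fun i _ => abs_nonneg _) fun i _ => hf _
    refine add_le_add (mul_le_of_le_one_right (abs_nonneg _) h1) ?_
    exact (mul_le_of_le_one_left (abs_nonneg _) (hg a)).trans ih

lemma abs_epsk_sub_le {d : ℕ} (k : Fin d → ℕ) (x y : EuclideanSpace ℝ (Fin d)) :
    |epsk k x - epsk k y| ≤ sumk k * ‖x - y‖ := by
  unfold epsk
  refine (abs_prod_sub_prod_le' _ _ _ (fun i => abs_eps1_le _ _) (fun i => abs_eps1_le _ _)).trans ?_
  unfold sumk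
  rw [Finset.sum_mul]
  refine Finset.sum_le_sum fun i _ => (abs_eps1_sub_le _ _ _).trans ?_
  gcongr
  have := PiLp.norm_apply_le (x - y) i
  simpa using this

lemma sq_epsk_sub_le {d : ℕ} (k : Fin d → ℕ) (x y : EuclideanSpace ℝ (Fin d)) (γ : ℝ) (h0 : 0 < γ)
    (h2 : γ ≤ 2) :
    (epsk k x - epsk k y) ^ 2 ≤ 4 * (sumk k * ‖x - y‖) ^ γ := by
  have hA := abs_epsk_sub_le k x y
  have hA0 : 0 ≤ sumk k * ‖x - y‖ := mul_nonneg (sumk_nonneg k) (norm_nonneg _)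
  have hB : |epsk k x - epsk k y| ≤ 2 := by
    refine (abs_sub _ _).trans ?_
    linarith [abs_epsk_le k x, abs_epsk_le k y]
  rw [← sq_abs]
  set A := sumk k * ‖x - y‖
  rcases le_total A 1 with h | h
  · have h1 : |epsk k x - epsk k y| ^ 2 ≤ A ^ 2 := by gcongr
    have h3 : A ^ 2 ≤ A ^ γ := by
      rcases hA0.eq_or_lt with h' | h'
      · rw [← h', Real.zero_rpow h0.ne']; norm_num
      · rw [← Real.rpow_two]
        exact Real.rpow_le_rpow_of_exponent_ge h' h h2
    have : 0 ≤ A ^ γ := Real.rpow_nonneg hA0 _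
    linarith
  · have := Real.one_le_rpow h h0.le
    nlinarith [abs_nonneg (epsk k x - epsk k y)]

lemma eps1_continuous (j : ℕ) : Continuous (eps1 j) := by
  unfold eps1
  split_ifs <;> fun_prop

lemma epsk_continuous {d : ℕ} (k : Fin d → ℕ) : Continuous (epsk k) := by
  unfold epsk
  refine continuous_finsetProd _ fun i _ => (eps1_continuous _).comp ?_
  fun_prop

lemma integral_cos_int (m : ℤ) (hm : m ≠ 0) : ∫ x in (0:ℝ)..π, Real.cos (m * x) = 0 := by
  have hm' : (m : ℝ) ≠ 0 := by exact_mod_cast hm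
  rw [intervalIntegral.integral_comp_mul_left (fun x => Real.cos x) hm']
  simp [Real.sin_int_mul_pi]

lemma integral_coscos (j l : ℕ) (h : j ≠ l) :
    ∫ x in (0:ℝ)..π, Real.cos (j * x) * Real.cos (l * x) = 0 := by
  have e : ∀ x : ℝ, Real.cos (j * x) * Real.cos (l * x) =
      2⁻¹ * (Real.cos (((j - l : ℤ) : ℝ) * x) + Real.cos (((j + l : ℤ) : ℝ) * x)) := by
    intro x
    push_cast
    rw [sub_mul, add_mul, Real.cos_sub, Real.cos_add]; ring
  simp_rw [e]
  rw [intervalIntegral.integral_const_mul, intervalIntegral.integral_add,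
    integral_cos_int _ (by omega), integral_cos_int _ (by omega)]
  · simp
  · exact Continuous.intervalIntegrable (by fun_prop) _ _
  · exact Continuous.intervalIntegrable (by fun_prop) _ _

lemma eps1_eq (j : ℕ) : ∃ c : ℝ, ∀ x, eps1 j x = c * Real.cos (j * x) := by
  by_cases h : j = 0
  · exact ⟨1 / √π, fun x => by simp [eps1, h]⟩
  · exact ⟨√(2 / π), fun x => by simp [eps1, h]⟩

lemma integral_eps1 (j l : ℕ) (h : j ≠ l) :
    ∫ x in Set.Ioo (0:ℝ) π, eps1 j x * eps1 l x = 0 := by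
  rw [← integral_Ioc_eq_integral_Ioo, ← intervalIntegral.integral_of_le Real.pi_pos.le]
  obtain ⟨c, hc⟩ := eps1_eq j
  obtain ⟨c', hc'⟩ := eps1_eq l
  have e : ∀ x : ℝ, eps1 j x * eps1 l x = (c * c') * (Real.cos (j * x) * Real.cos (l * x)) := by
    intro x; rw [hc, hc']; ring
  simp_rw [e]
  rw [intervalIntegral.integral_const_mul, integral_coscos j l h, mul_zero]

lemma domD_eq (d : ℕ) : domD d = (WithLp.ofLp) ⁻¹' (Set.univ.pi fun _ : Fin d => Set.Ioo (0:ℝ) π) := by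
  ext x; simp [domD]

lemma measurableSet_domD (d : ℕ) : MeasurableSet (domD d) := by
  rw [domD_eq]
  exact (PiLp.volume_preserving_ofLp (Fin d)).measurable
    (MeasurableSet.univ_pi fun _ => measurableSet_Ioo)

lemma volume_domD (d : ℕ) : volume (domD d) = ENNReal.ofReal (π ^ d) := by
  rw [domD_eq, (PiLp.volume_preserving_ofLp (Fin d)).measure_preimage
    (MeasurableSet.univ_pi fun _ => measurableSet_Ioo).nullMeasurableSet]
  simp [volume_pi_pi, Real.volume_Ioo, ENNReal.ofReal_pow Real.pi_pos.le]

lemma integral_epsk {d : ℕ} (k l : Fin d → ℕ) (h : k ≠ l) :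
    ∫ z in domD d, epsk k z * epsk l z = 0 := by
  have e : ∀ z : EuclideanSpace ℝ (Fin d), epsk k z * epsk l z =
      (fun w : Fin d → ℝ => ∏ i, (eps1 (k i) (w i) * eps1 (l i) (w i))) (WithLp.ofLp z) := by
    intro z; simp [epsk, Finset.prod_mul_distrib]
  simp_rw [e]
  rw [domD_eq, (PiLp.volume_preserving_ofLp (Fin d)).setIntegral_preimage_emb
    (MeasurableEquiv.toLp 2 (Fin d → ℝ)).symm.measurableEmbedding
    (fun w : Fin d → ℝ => ∏ i, (eps1 (k i) (w i) * eps1 (l i) (w i))), volume_pi, Measure.restrict_pi_pi,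
    integral_fintype_prod_eq_prod (fun i x => eps1 (k i) x * eps1 (l i) x)]
  obtain ⟨i, hi⟩ := Function.ne_iff.1 h
  exact Finset.prod_eq_zero (Finset.mem_univ i) (integral_eps1 _ _ hi)

lemma integrableOn_epsk {d : ℕ} (k l : Fin d → ℕ) :
    IntegrableOn (fun z => epsk k z * epsk l z) (domD d) := by
  refine Measure.integrableOn_of_bounded (M := 1) ?_ ?_ ?_
  · rw [volume_domD]; exact ENNReal.ofReal_ne_top
  · exact ((epsk_continuous k).mul (epsk_continuous l)).aestronglyMeasurable
  · refine ae_of_all _ fun z => ?_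
    rw [Real.norm_eq_abs, abs_mul]
    exact mul_le_one₀ (abs_epsk_le _ _) (abs_nonneg _) (abs_epsk_le _ _)

lemma integral_abs_epsk_le {d : ℕ} (k l : Fin d → ℕ) :
    ∫ z in domD d, |epsk k z * epsk l z| ≤ π ^ d := by
  have h : ∫ z in domD d, |epsk k z * epsk l z| ≤ ∫ z in domD d, (1:ℝ) := by
    refine integral_mono (integrableOn_epsk k l).abs ?_ fun z => ?_
    · exact integrableOn_const (by rw [volume_domD]; exact ENNReal.ofReal_ne_top)
    · simp only [abs_mul]
      exact mul_le_one₀ (abs_epsk_le _ _) (abs_nonneg _) (abs_epsk_le _ _)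
  refine h.trans ?_
  simp [Measure.real, volume_domD, Real.pi_pos.le]

lemma parseval_le {d : ℕ} (a : (Fin d → ℕ) → ℝ) (ha : Summable a) :
    ∫ z in domD d, (∑' k, a k * epsk k z) ^ 2 = ∑' k, a k ^ 2 * ∫ z in domD d, epsk k z ^ 2 := by
  have hn : Summable fun k => ‖a k‖ := ha.norm
  have hs : ∀ z : EuclideanSpace ℝ (Fin d), Summable fun k => ‖a k * epsk k z‖ := fun z =>
    Summable.of_nonneg_of_le (fun _ => norm_nonneg _) (fun k => by
      rw [norm_mul]
      exact mul_le_of_le_one_right (norm_nonneg _) (abs_epsk_le k z)) hn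
  have hnn : Summable fun p : (Fin d → ℕ) × (Fin d → ℕ) => ‖a p.1 * a p.2‖ := by
    simpa [norm_mul] using hn.mul_of_nonneg hn (fun _ => norm_nonneg _) (fun _ => norm_nonneg _)
  have e : ∀ z : EuclideanSpace ℝ (Fin d), (∑' k, a k * epsk k z) ^ 2 =
      ∑' p : (Fin d → ℕ) × (Fin d → ℕ), (a p.1 * a p.2) * (epsk p.1 z * epsk p.2 z) := by
    intro z
    rw [sq, tsum_mul_tsum_of_summable_norm (hs z) (hs z)]
    exact tsum_congr fun p => by ring
  simp_rw [e]
  have hb : ∀ p : (Fin d → ℕ) × (Fin d → ℕ),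
      ‖∫ z in domD d, (a p.1 * a p.2) * (epsk p.1 z * epsk p.2 z)‖ ≤ ‖a p.1 * a p.2‖ * π ^ d := by
    intro p
    rw [integral_const_mul, norm_mul]
    gcongr
    exact (norm_integral_le_integral_norm _).trans (integral_abs_epsk_le _ _)
  rw [← integral_tsum_of_summable_integral_norm]
  · rw [Summable.tsum_prod (Summable.of_norm_bounded (hnn.mul_right (π ^ d)) hb)]
    refine tsum_congr fun k => ?_
    rw [tsum_eq_single k]
    · rw [integral_const_mul, sq]; simp_rw [sq]
    · intro l hl
      rw [integral_const_mul, integral_epsk _ _ hl.symm, mul_zero]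
  · intro p
    exact (integrableOn_epsk _ _).const_mul _
  · refine Summable.of_nonneg_of_le (fun p => integral_nonneg fun z => norm_nonneg _) (fun p => ?_)
      (hnn.mul_right (π ^ d))
    simp only [norm_mul (a p.1 * a p.2)]
    rw [integral_const_mul]
    gcongr
    exact integral_abs_epsk_le _ _

lemma green_sq {d : ℕ} (x y : EuclideanSpace ℝ (Fin d)) (s : ℝ) (hs : 0 < s) :
    ∫ z in domD d, |green x z s - green y z s| ^ 2 =
      ∑' k, (Real.exp (-(lam k ^ 2 + lam k) * s) * (epsk k x - epsk k y)) ^ 2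
        * ∫ z in domD d, epsk k z ^ 2 := by
  have hS : ∀ (x z : EuclideanSpace ℝ (Fin d)),
      Summable fun k => Real.exp (-(lam k ^ 2 + lam k) * s) * epsk k x * epsk k z := fun x z =>
    Summable.of_norm_bounded (summable_exp s hs) fun k => by
      rw [norm_mul, norm_mul, Real.norm_of_nonneg (Real.exp_nonneg _), mul_assoc]
      exact mul_le_of_le_one_right (Real.exp_nonneg _)
        (mul_le_one₀ (abs_epsk_le _ _) (abs_nonneg _) (abs_epsk_le _ _))
  rw [← parseval_le]
  · congr 1
    ext z
    rw [sq_abs, green, green, ← (hS x z).tsum_sub (hS y z)]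
    congr 1
    exact tsum_congr fun k => by ring
  · refine Summable.of_norm_bounded ((summable_exp s hs).mul_right 2) fun k => ?_
    rw [norm_mul, Real.norm_of_nonneg (Real.exp_nonneg _)]
    gcongr
    refine (abs_sub _ _).trans ?_
    linarith [abs_epsk_le k x, abs_epsk_le k y]

lemma integral_exp_le (m t : ℝ) (hm : 0 < m) :
    ∫ r in (0:ℝ)..t, Real.exp (-m * (t - r)) ^ 2 ≤ 1 / (2 * m) := by
  have h : ∀ r ∈ Set.uIcc 0 t, HasDerivAt (fun r => Real.exp (-m * (t - r)) ^ 2 / (2 * m))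
      (Real.exp (-m * (t - r)) ^ 2) r := by
    intro r _
    have := (((((hasDerivAt_id r).const_sub t).const_mul (-m)).exp).pow 2).div_const (2 * m)
    refine this.congr_deriv ?_
    simp
    field_simp
  rw [intervalIntegral.integral_eq_sub_of_hasDerivAt h
    (Continuous.intervalIntegrable (by fun_prop) _ _)]
  simp only [sub_self, mul_zero, Real.exp_zero, one_pow]
  have : 0 ≤ Real.exp (-m * (t - 0)) ^ 2 / (2 * m) := by positivity
  linarith

lemma term_le {d : ℕ} (k : Fin d → ℕ) (x y : EuclideanSpace ℝ (Fin d)) (γ t : ℝ) (h0 : 0 < γ)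
    (h2 : γ ≤ 2) (ht : 0 < t) :
    ∫ r in Set.Ioo 0 t, (Real.exp (-(lam k ^ 2 + lam k) * (t - r)) * (epsk k x - epsk k y)) ^ 2
        * ∫ z in domD d, epsk k z ^ 2 ≤
      (2 * d ^ 2 * π ^ d * ‖x - y‖ ^ γ) * sumk k ^ (-(4 - γ)) := by
  have hV0 : 0 ≤ ∫ z in domD d, epsk k z ^ 2 := integral_nonneg fun z => sq_nonneg _
  have hV : ∫ z in domD d, epsk k z ^ 2 ≤ π ^ d := by
    have := integral_abs_epsk_le k k
    simpa [← sq] using this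
  set V := ∫ z in domD d, epsk k z ^ 2
  have hb := sq_epsk_sub_le k x y γ h0 h2
  have hR : 0 ≤ (2 * d ^ 2 * π ^ d * ‖x - y‖ ^ γ) * sumk k ^ (-(4 - γ)) := by
    have := Real.rpow_nonneg (sumk_nonneg k) (-(4 - γ))
    positivity
  rcases sumk_cases k with hk | hk
  · have hz : epsk k x - epsk k y = 0 := by subst hk; simp [epsk, eps1]
    simpa [hz] using hR
  have hl := sumk_le_lam k
  have hm : 0 < lam k ^ 2 + lam k := by nlinarith
  have hI := integral_exp_le _ t hm
  rw [intervalIntegral.integral_of_le ht.le, integral_Ioc_eq_integral_Ioo] at hI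
  simp_rw [mul_pow, mul_assoc]
  rw [integral_mul_const]
  have hN : 0 < sumk k := by linarith
  rw [Real.mul_rpow hN.le (norm_nonneg _)] at hb
  have hd2 : sumk k ^ 4 ≤ d ^ 2 * (lam k ^ 2 + lam k) := by
    have h1 := sumk_sq_le k
    have h3 : (sumk k ^ 2) ^ 2 ≤ (d * lam k) ^ 2 := by gcongr
    have h4 : 0 ≤ (d:ℝ) ^ 2 * lam k := mul_nonneg (sq_nonneg _) (lam_nonneg k)
    nlinarith
  have h5 : 1 / (2 * (lam k ^ 2 + lam k)) ≤ d ^ 2 / (2 * sumk k ^ 4) := by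
    rw [div_le_div_iff₀ (by positivity) (by positivity)]
    nlinarith
  calc _ ≤ (d ^ 2 / (2 * sumk k ^ 4)) * ((4 * (sumk k ^ γ * ‖x - y‖ ^ γ)) * π ^ d) := by
        gcongr
        exact hI.trans h5
    _ = _ := by
        rw [show -(4 - γ) = γ - (4:ℕ) by push_cast; ring, Real.rpow_sub_natCast hN.ne']
        field_simp
        ring

/-- Hölder estimate in space for the squared `L²`-in-space-and-time increment of the
Green's function: for `0 < γ < 4 − d`, `γ ≤ 2` there is `C > 0` such that
`∫_0^t ∫_D |G(x,z,t−r) − G(y,z,t−r)|² dz dr ≤ C |x−y|^γ`. -/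
theorem statement6 (d : ℕ) (hd : d = 1 ∨ d = 2 ∨ d = 3) (γ : ℝ)
    (hγ0 : 0 < γ) (hγ1 : γ < 4 - (d : ℝ)) (hγ2 : γ ≤ 2) :
    ∃ C > (0 : ℝ), ∀ t : ℝ, 0 < t → ∀ x ∈ domD d, ∀ y ∈ domD d,
      (∫ r in (0 : ℝ)..t, ∫ z in domD d,
          |green x z (t - r) - green y z (t - r)| ^ 2)
        ≤ C * ‖x - y‖ ^ γ := by
  have hd0 : 0 < d := by omega
  have hS := summable_sumk hd0 (4 - γ) (by linarith)
  have hSn : 0 ≤ ∑' k : Fin d → ℕ, sumk k ^ (-(4 - γ)) :=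
    tsum_nonneg fun k => Real.rpow_nonneg (sumk_nonneg k) _
  refine ⟨2 * d ^ 2 * π ^ d * (∑' k : Fin d → ℕ, sumk k ^ (-(4 - γ))) + 1, by positivity, ?_⟩
  intro t ht x _ y _
  rw [intervalIntegral.integral_of_le ht.le, integral_Ioc_eq_integral_Ioo]
  have hS' := hS.mul_left (2 * d ^ 2 * π ^ d * ‖x - y‖ ^ γ)
  have hI0 : ∀ (k : Fin d → ℕ) (r : ℝ),
      0 ≤ (Real.exp (-(lam k ^ 2 + lam k) * (t - r)) * (epsk k x - epsk k y)) ^ 2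
        * ∫ z in domD d, epsk k z ^ 2 := fun k r =>
    mul_nonneg (sq_nonneg _) (integral_nonneg fun z => sq_nonneg _)
  have hterm := fun k : Fin d → ℕ => term_le k x y γ t hγ0 hγ2 ht
  have hsum : Summable fun k : Fin d → ℕ => ∫ r in Set.Ioo 0 t,
      (Real.exp (-(lam k ^ 2 + lam k) * (t - r)) * (epsk k x - epsk k y)) ^ 2
        * ∫ z in domD d, epsk k z ^ 2 :=
    Summable.of_nonneg_of_le (fun k => integral_nonneg (hI0 k)) hterm hS'
  rw [setIntegral_congr_fun measurableSet_Ioo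
    (fun r hr => green_sq x y (t - r) (by linarith [hr.2])),
    ← integral_tsum_of_summable_integral_norm]
  · refine (hsum.tsum_le_tsum hterm hS').trans ?_
    rw [tsum_mul_left, add_mul, one_mul]
    have := Real.rpow_nonneg (norm_nonneg (x - y)) γ
    nlinarith
  · intro k
    have hc : Continuous fun r : ℝ =>
        (Real.exp (-(lam k ^ 2 + lam k) * (t - r)) * (epsk k x - epsk k y)) ^ 2
          * ∫ z in domD d, epsk k z ^ 2 := by fun_prop
    exact (hc.integrableOn_Icc).mono_set Set.Ioo_subset_Icc_self
  · simp_rw [Real.norm_of_nonneg (hI0 _ _)]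
    exact hsum
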